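/- For every finitely presented group G there exists a finite subset X ⊆ ℝ⁴ such that the fundamental group of the Rips complex R(X) is isomorphic to G. -/

import Mathlib

open Metric Function

/-- The geometric realization of the Rips complex `R(X) = R(X;1)` of a set `X ⊆ ℝ⁴`:
formal convex combinations of the points of `X` whose support is a face of `R(X)`
(i.e. a finite subset of `X` of diameter `< 1`), topologized as a subspace of the
product `(ℝ⁴) → ℝ`. (For finite `X` this carries the usual topology of the geometric
realization.) -/
def ripsRealization (X : Set (EuclideanSpace ℝ (Fin 4))) :
    Set ((EuclideanSpace ℝ (Fin 4)) → ℝ) :=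
  {f | (∀ v, 0 ≤ f v) ∧ (support f).Finite ∧ support f ⊆ X ∧
    Metric.diam (support f) < 1 ∧ ∑ᶠ v, f v = 1}

section FundamentalGroupOfCover

open CategoryTheory Set

/-- `LabelledReach A c u v g` says that there is a walk from `u` to `v` along the relation `A`
whose `c`-labels multiply to `g`. -/
inductive LabelledReach {V G : Type*} [Group G] (A : V → V → Prop) (c : V → V → G) (u : V) :
    V → G → Prop
  | refl : LabelledReach A c u u 1
  | step {v w : V} {g : G} : LabelledReach A c u v g → A v w →
      LabelledReach A c u w (g * c v w)

/-- A labelling is a cocycle if it is multiplicative on all triangles of the relation `A`. -/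
def IsCocycle {V G : Type*} [Group G] (A : V → V → Prop) (c : V → V → G) : Prop :=
  ∀ u v w, A u v → A v w → A u w → c u v * c v w = c u w

variable {Y : Type} [TopologicalSpace Y]

/-- The homotopy class of the paths between two points of a simply connected set that stay
inside this set. -/
noncomputable def innerClass {s : Set Y} (hs : IsSimplyConnected s) {y z : Y} (hy : y ∈ s)
    (hz : z ∈ s) : FundamentalGroupoid.mk y ⟶ FundamentalGroupoid.mk z :=
  Path.Homotopic.Quotient.mk (hs.isPathConnected.joinedIn y hy z hz).somePath

theorem innerClass_eq_mk {s : Set Y} (hs : IsSimplyConnected s) {y z : Y} (hy : y ∈ s)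
    (hz : z ∈ s) (γ : Path y z) (hγ : ∀ t, γ t ∈ s) :
    innerClass hs hy hz = Path.Homotopic.Quotient.mk γ := by
  have := hs.simplyConnectedSpace
  have key : ∀ γ : Path y z, ∀ hγ : ∀ t, γ t ∈ s, ∃ γ' : Path (⟨y, hy⟩ : s) ⟨z, hz⟩,
      γ = γ'.map continuous_subtype_val := fun γ hγ =>
    ⟨⟨⟨fun t => ⟨γ t, hγ t⟩, by fun_prop⟩, by simp, by simp⟩, by ext; rfl⟩
  obtain ⟨γ', h'⟩ := key γ hγ
  obtain ⟨δ', h''⟩ := key _ (hs.isPathConnected.joinedIn y hy z hz).somePath_mem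
  rw [innerClass, h', h'', Path.Homotopic.Quotient.eq]
  exact (SimplyConnectedSpace.paths_homotopic δ' γ').map ⟨_, continuous_subtype_val⟩

theorem innerClass_comp {s : Set Y} (hs : IsSimplyConnected s) {x y z : Y} (hx : x ∈ s)
    (hy : y ∈ s) (hz : z ∈ s) :
    innerClass hs hx hy ≫ innerClass hs hy hz = innerClass hs hx hz := by
  obtain ⟨γ, hγ⟩ := hs.isPathConnected.joinedIn x hx y hy
  obtain ⟨γ', hγ'⟩ := hs.isPathConnected.joinedIn y hy z hz
  rw [innerClass_eq_mk hs hx hy γ hγ, innerClass_eq_mk hs hy hz γ' hγ',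
    innerClass_eq_mk hs hx hz (γ.trans γ')]
  · rfl
  · intro t
    have : γ.trans γ' t ∈ range (γ.trans γ') := mem_range_self t
    rw [Path.trans_range] at this
    rcases this with ⟨a, ha⟩ | ⟨a, ha⟩
    · exact ha ▸ hγ a
    · exact ha ▸ hγ' a

theorem innerClass_self {s : Set Y} (hs : IsSimplyConnected s) {x : Y} (hx : x ∈ s) :
    innerClass hs hx hx = 𝟙 _ :=
  innerClass_eq_mk hs hx hx (Path.refl x) fun _ => hx

theorem innerClass_congr {s t : Set Y} (hs : IsSimplyConnected s) (ht : IsSimplyConnected t)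
    (hst : IsPathConnected (s ∩ t)) {y z : Y} (hy : y ∈ s ∩ t) (hz : z ∈ s ∩ t) :
    innerClass hs hy.1 hz.1 = innerClass ht hy.2 hz.2 := by
  obtain ⟨γ, hγ⟩ := hst.joinedIn y hy z hz
  rw [innerClass_eq_mk hs _ _ γ fun t => (hγ t).1, innerClass_eq_mk ht _ _ γ fun t => (hγ t).2]

/-- The principal bundle with discrete fibre `G` given by a locally constant cocycle on
an open cover. -/
noncomputable def cocycleBundle {V G : Type} [Group G] [TopologicalSpace G] [DiscreteTopology G]
    (U : V → Set Y) (hU : ∀ v, IsOpen (U v)) (hcover : ∀ y, ∃ v, y ∈ U v) (c : V → V → G)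
    (hc : IsCocycle (fun u v => (U u ∩ U v).Nonempty) c) : FiberBundleCore V Y G where
  baseSet := U
  isOpen_baseSet := hU
  indexAt y := (hcover y).choose
  mem_baseSet_at y := (hcover y).choose_spec
  coordChange u v _ g := g * c u v
  coordChange_self u y hy g := by
    have h : (U u ∩ U u).Nonempty := ⟨y, hy, hy⟩
    simpa using hc u u u h h h
  continuousOn_coordChange u v :=
    ((continuous_of_discreteTopology (f := fun g : G => g * c u v)).comp
      continuous_snd).continuousOn
  coordChange_comp u v w y hy g := by
    rw [mul_assoc, hc u v w ⟨y, hy.1⟩ ⟨y, hy.1.2, hy.2⟩ ⟨y, hy.1.1, hy.2⟩]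

/-- If the cover admits a `G`-cocycle, then the product of labels along a closed walk which is
null-homotopic is trivial; more precisely, walks are tracked by a function on homotopy classes. -/
theorem exists_holonomy {V G : Type} [Group G]
    (U : V → Set Y) (hU : ∀ v, IsOpen (U v)) (hcover : ∀ y, ∃ v, y ∈ U v)
    (hsc : ∀ v, (U v).Nonempty → IsSimplyConnected (U v)) (c : V → V → G)
    (hc : IsCocycle (fun u v => (U u ∩ U v).Nonempty) c) :
    ∃ F : ∀ (_ _ : V) (y z : Y), (FundamentalGroupoid.mk y ⟶ FundamentalGroupoid.mk z) → G → G,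
      (∀ v w y z (hy : y ∈ U v) (hz : z ∈ U v) (_ : z ∈ U w) g,
        F v w y z (innerClass (hsc v ⟨y, hy⟩) hy hz) g = g * c v w) ∧
      (∀ u v w x y z P Q g,
        F u w x z (P ≫ Q) g = F v w y z Q (F u v x y P g)) := by
  let _ : TopologicalSpace G := ⊥
  have : DiscreteTopology G := ⟨rfl⟩
  let Z := cocycleBundle U hU hcover c hc
  have cov : IsCoveringMap Z.proj := IsFiberBundle.isCoveringMap fun y =>
    ⟨Z.localTrivAt y, Z.mem_baseSet_at y⟩
  let p : V → Y → G → Z.TotalSpace := fun v y g => ⟨y, (g * c v (Z.indexAt y) : G)⟩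
  have hcc : ∀ u v w y, y ∈ U u → y ∈ U v → y ∈ U w → c u v * c v w = c u w :=
    fun u v w y hu hv hw => hc u v w ⟨y, hu, hv⟩ ⟨y, hv, hw⟩ ⟨y, hu, hw⟩
  let snd : Z.TotalSpace → G := fun e => e.2
  let F : ∀ (v w : V) (y z : Y), (FundamentalGroupoid.mk y ⟶ FundamentalGroupoid.mk z) → G → G :=
    fun v w y z P g =>
      snd (cov.monodromy P (⟨p v y g, rfl⟩ : Z.proj ⁻¹' {y})) * (c w (Z.indexAt z))⁻¹
  have hF : ∀ v w y z P g,
      cov.monodromy P (⟨p v y g, rfl⟩ : Z.proj ⁻¹' {y}) = ⟨p w z (F v w y z P g), rfl⟩ := by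
    intro v w y z P g
    have key : ∀ e : Z.proj ⁻¹' {z}, e = ⟨p w z (snd e * (c w (Z.indexAt z))⁻¹), rfl⟩ := by
      rintro ⟨⟨z', g'⟩, hz'⟩
      obtain rfl : z' = z := hz'
      exact congrArg (fun a : G => (⟨⟨z', a⟩, rfl⟩ : Z.proj ⁻¹' {z'}))
        (inv_mul_cancel_right (G := G) g' (c w (Z.indexAt z'))).symm
    exact key _
  refine ⟨F, ?_, ?_⟩
  · intro v w y z hy hz hzw g
    have hs := hsc v ⟨y, hy⟩
    obtain ⟨γ, hγ⟩ := hs.isPathConnected.joinedIn y hy z hz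
    rw [innerClass_eq_mk hs hy hz γ hγ]
    have hcont : Continuous fun t => p v (γ t) g := by
      have := (Z.localTriv v).toOpenPartialHomeomorph.symm.continuousOn.comp_continuous
        (f := fun t => (γ t, g)) (by fun_prop) (fun t => by
          exact (Z.mem_localTriv_target v _).2 (hγ t))
      exact this
    let Γ : Path (p v y g) (p v z g) := ⟨⟨_, hcont⟩, by simp, by simp⟩
    have h := cov.monodromy_map (Path.Homotopic.Quotient.mk Γ)
    have h2 : cov.monodromy (Path.Homotopic.Quotient.mk γ) (⟨p v y g, rfl⟩ : Z.proj ⁻¹' {y})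
      = ⟨p v z g, rfl⟩ := h
    simp only [F]
    rw [h2]
    change g * c v (Z.indexAt z) * (c w (Z.indexAt z))⁻¹ = g * c v w
    rw [← hcc v w (Z.indexAt z) z hz hzw (Z.mem_baseSet_at z)]
    group
  · intro u v w x y z P Q g
    have h := cov.monodromy_trans_apply P Q (⟨p u x g, rfl⟩ : Z.proj ⁻¹' {x})
    rw [hF u v x y P g] at h
    simp only [F] at h ⊢
    erw [h]

/-- A property of homotopy classes of paths that is preserved by appending paths inside the
members of an open cover is preserved by appending arbitrary paths. -/
theorem comp_induction_of_open_cover {V : Type} {U : V → Set Y} (hU : ∀ v, IsOpen (U v))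
    (hcover : ∀ y, ∃ v, y ∈ U v) {x : Y}
    (good : ∀ z, (FundamentalGroupoid.mk x ⟶ FundamentalGroupoid.mk z) → Prop)
    (hgood : ∀ z z' P v (δ : Path z z'), (∀ t, δ t ∈ U v) → good z P →
      good z' (P ≫ Path.Homotopic.Quotient.mk δ))
    {z z' : Y} (P : FundamentalGroupoid.mk x ⟶ FundamentalGroupoid.mk z) (hP : good z P)
    (Q : FundamentalGroupoid.mk z ⟶ FundamentalGroupoid.mk z') : good z' (P ≫ Q) := by
  obtain ⟨γ, rfl⟩ : ∃ γ : Path z z', Path.Homotopic.Quotient.mk γ = Q :=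
    Path.Homotopic.Quotient.mk_surjective Q
  obtain ⟨γ, rfl, rfl⟩ := γ
  set γ' : Path (γ.toFun 0) (γ.toFun 1) := ⟨γ, rfl, rfl⟩
  obtain ⟨t, ht0, htm, ⟨n, hn⟩, ht⟩ := exists_monotone_Icc_subset_open_cover_unitInterval
    (c := fun v => γ' ⁻¹' U v) (fun v => (hU v).preimage γ'.continuous)
    (fun s _ => mem_iUnion.2 (hcover (γ' s)))
  have key : ∀ k, good (γ' (t k)) (P ≫ Path.Homotopic.Quotient.mk (γ'.subpath 0 (t k))) := by
    intro k
    induction k with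
    | zero =>
      rw [ht0, Path.subpath_self]
      exact (Category.comp_id P).symm ▸ hP
    | succ k ih =>
      obtain ⟨v, hv⟩ := ht k
      have h := hgood _ _ _ v (γ'.subpath (t k) (t (k + 1))) (fun s => by
        have : γ'.subpath (t k) (t (k + 1)) s ∈ range (γ'.subpath (t k) (t (k + 1))) :=
          mem_range_self s
        rw [Path.range_subpath_of_le _ _ _ (htm k.le_succ)] at this
        obtain ⟨r, hr, hr'⟩ := this
        exact hr' ▸ hv hr) ih
      rw [Category.assoc] at h
      have h2 : Path.Homotopic.Quotient.mk (γ'.subpath 0 (t (k + 1))) =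
          Path.Homotopic.Quotient.mk ((γ'.subpath 0 (t k)).trans
            (γ'.subpath (t k) (t (k + 1)))) :=
        (Path.Homotopic.Quotient.eq.2
          ⟨Path.Homotopy.subpathTransSubpath γ' 0 (t k) (t (k + 1))⟩).symm
      rw [h2]
      exact h
  have h := key n
  rw [hn n le_rfl, Path.subpath_zero_one] at h
  exact h

/-- The fundamental group of a space with an open cover by simply connected sets, with
path-connected double intersections and such that pairwise intersecting triples have a common
point, is the group classifying the cocycles on the nerve of the cover. -/
theorem nonempty_fundamentalGroup_mulEquiv_of_cover {V G : Type} [Group G]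
    (U : V → Set Y) (hU : ∀ v, IsOpen (U v)) (hcover : ∀ y, ∃ v, y ∈ U v)
    (hsc : ∀ v, (U v).Nonempty → IsSimplyConnected (U v))
    (hpc : ∀ u v, (U u ∩ U v).Nonempty → IsPathConnected (U u ∩ U v))
    (h3 : ∀ u v w, (U u ∩ U v).Nonempty → (U v ∩ U w).Nonempty → (U u ∩ U w).Nonempty →
      (U u ∩ U v ∩ U w).Nonempty)
    (c : V → V → G) (hc : IsCocycle (fun u v => (U u ∩ U v).Nonempty) c)
    (univ : ∀ (H : Type) [Group H] (c' : V → V → H),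
      IsCocycle (fun u v => (U u ∩ U v).Nonempty) c' →
      ∃ (φ : G →* H) (f : V → H), ∀ u v, (U u ∩ U v).Nonempty →
        c' u v = (f u)⁻¹ * φ (c u v) * f v)
    (v₀ : V) (gen : ∀ g, LabelledReach (fun u v => (U u ∩ U v).Nonempty) c v₀ v₀ g)
    (conn : ∀ v, (U v).Nonempty →
      ∃ g, LabelledReach (fun u v => (U u ∩ U v).Nonempty) c v₀ v g)
    (y₀ : Y) (hy₀ : y₀ ∈ U v₀) : Nonempty (FundamentalGroup Y y₀ ≃* G) := by
  classical
  set A : V → V → Prop := fun u v => (U u ∩ U v).Nonempty with hA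
  obtain ⟨y, rfl, hy⟩ : ∃ y : V → Y, y v₀ = y₀ ∧ ∀ v, (U v).Nonempty → y v ∈ U v := by
    refine ⟨fun v => if v = v₀ then y₀ else if h : (U v).Nonempty then h.some else y₀,
      by simp, fun v hv => ?_⟩
    by_cases h : v = v₀
    · subst h; simpa using hy₀
    · simpa [h, hv] using hv.some_mem
  have hyl : ∀ {u v}, A u v → y u ∈ U u := fun {u v} h => hy u h.left
  have hyr : ∀ {u v}, A u v → y v ∈ U v := fun {u v} h => hy v h.right
  obtain ⟨I, hI⟩ : ∃ I : ∀ v a b, a ∈ U v → b ∈ U v → (FundamentalGroupoid.mk a ⟶ .mk b),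
      ∀ v a b ha hb, I v a b ha hb = innerClass (hsc v (nonempty_of_mem ha)) ha hb :=
    ⟨_, fun _ _ _ _ _ => rfl⟩
  have I_comp : ∀ v a b d ha hb hd, I v a b ha hb ≫ I v b d hb hd = I v a d ha hd := by
    intro v a b d ha hb hd
    rw [hI, hI, hI, innerClass_comp]
  have I_self : ∀ v a ha, I v a a ha ha = 𝟙 _ := by
    intro v a ha
    rw [hI, innerClass_self]
  have I_congr : ∀ u v a b (hau : a ∈ U u) (hav : a ∈ U v) (hbu : b ∈ U u) (hbv : b ∈ U v),
      I u a b hau hbu = I v a b hav hbv := by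
    intro u v a b hau hav hbu hbv
    rw [hI, hI]
    exact innerClass_congr _ _ (hpc u v ⟨a, hau, hav⟩) ⟨hau, hav⟩ ⟨hbu, hbv⟩
  obtain ⟨e, he⟩ : ∃ e : ∀ u v, A u v → (FundamentalGroupoid.mk (y u) ⟶ .mk (y v)),
      ∀ u v (h : A u v) z (hzu : z ∈ U u) (hzv : z ∈ U v),
        e u v h = I u _ z (hyl h) hzu ≫ I v z _ hzv (hyr h) := by
    have : Nonempty Y := ⟨y v₀⟩
    choose! z hz using fun u v (h : A u v) => h
    refine ⟨fun u v h => I u _ (z u v) (hyl h) (hz u v h).1 ≫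
      I v (z u v) _ (hz u v h).2 (hyr h), fun u v h x hxu hxv => ?_⟩
    obtain ⟨hzu, hzv⟩ := hz u v h
    beta_reduce
    rw [← I_comp u _ x _ (hyl h) hxu hzu, Category.assoc,
      I_congr u v _ _ hxu hxv hzu hzv, I_comp]
  have hee : ∀ u v w (h₁ : A u v) (h₂ : A v w) (h₃ : A u w), e u v h₁ ≫ e v w h₂ = e u w h₃ := by
    intro u v w h₁ h₂ h₃
    obtain ⟨z, ⟨hu, hv⟩, hw⟩ := h3 u v w h₁ h₂ h₃
    rw [he u v h₁ z hu hv, he v w h₂ z hv hw, he u w h₃ z hu hw, Category.assoc,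
      ← Category.assoc (I v _ _ _ _), I_comp, I_self, Category.id_comp]
  have hτ : ∀ v, (U v).Nonempty → Nonempty (FundamentalGroupoid.mk (y v₀) ⟶ .mk (y v)) := by
    intro v hv
    obtain ⟨g, hg⟩ := conn v hv
    clear hv
    induction hg with
    | refl => exact ⟨𝟙 _⟩
    | step _ h ih => exact ⟨ih.some ≫ e _ _ h⟩
  let τ := fun v hv => (hτ v hv).some
  obtain ⟨c', hc'⟩ : ∃ c' : V → V → (FundamentalGroupoid.mk (y v₀) ⟶ .mk (y v₀)), ∀ u v (h : A u v),
      c' u v = (τ u h.left ≫ e u v h ≫ inv (τ v h.right)) := by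
    refine ⟨fun u v => if h : A u v then
      (τ u h.left ≫ e u v h ≫ inv (τ v h.right)) else 1, fun u v h => dif_pos h⟩
  have mul_def : ∀ p q : FundamentalGroupoid.mk (y v₀) ⟶ .mk (y v₀), p * q = p ≫ q :=
    fun _ _ => rfl
  have one_def : (1 : FundamentalGroupoid.mk (y v₀) ⟶ .mk (y v₀)) = 𝟙 _ := rfl
  obtain ⟨φ, f, hφ⟩ := univ _ c' (by
    intro u v w h₁ h₂ h₃
    rw [hc' u v h₁, hc' v w h₂, hc' u w h₃, mul_def, ← hee u v w h₁ h₂ h₃]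
    simp)
  have h₀ : (U v₀).Nonempty := ⟨_, hy₀⟩
  obtain ⟨F, hF1, hF2⟩ := exists_holonomy U hU hcover hsc c hc
  have hFI : ∀ v w a b (ha : a ∈ U v) (hb : b ∈ U v) (_ : b ∈ U w) g,
      F v w a b (I v a b ha hb) g = g * c v w := by
    intro v w a b ha hb hbw g
    rw [hI, hF1 v w a b ha hb hbw g]
  have hc1 : ∀ v, (U v).Nonempty → c v v = 1 := by
    intro v hv
    have h : A v v := by simpa [hA] using hv
    simpa using hc v v v h h h
  have walk : ∀ v g, LabelledReach A c v₀ v g → ∃ (hv : (U v).Nonempty)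
      (P : FundamentalGroupoid.mk (y v₀) ⟶ .mk (y v)),
      (τ v₀ h₀ ≫ P ≫ inv (τ v hv)) = (f v₀)⁻¹ * φ g * f v ∧
      F v₀ v _ _ P 1 = g := by
    intro v g hg
    induction hg with
    | refl =>
      refine ⟨h₀, 𝟙 _, ?_, ?_⟩
      · simp [one_def]
      · rw [← I_self v₀ _ hy₀, hFI v₀ v₀ _ _ hy₀ hy₀ hy₀, hc1 v₀ h₀, one_mul]
    | @step v w g hg h ih =>
      obtain ⟨hv, P, hP, hP'⟩ := ih
      refine ⟨h.right, P ≫ e v w h, ?_, ?_⟩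
      · have : (τ v₀ h₀ ≫ (P ≫ e v w h) ≫ inv (τ w h.right)) =
            (τ v₀ h₀ ≫ P ≫ inv (τ v hv)) * c' v w := by
          rw [hc' v w h, mul_def]
          simp
        rw [this, hP, hφ v w h, map_mul]
        group
      · obtain ⟨z, hzv, hzw⟩ := id h
        rw [hF2 v₀ v w _ (y v), hP', he v w h z hzv hzw, hF2 v w w _ z,
          hFI v w _ _ _ _ hzw, hFI w w _ _ _ _ (hyr h), hc1 w h.right, mul_one]
  let good : ∀ z, (FundamentalGroupoid.mk (y v₀) ⟶ FundamentalGroupoid.mk z) → Prop :=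
    fun z P => ∀ v (hz : z ∈ U v), ∃ g,
      (τ v₀ h₀ ≫ P ≫ I v z _ hz (hy v ⟨z, hz⟩) ≫ inv (τ v ⟨z, hz⟩)) =
        (f v₀)⁻¹ * φ g * f v
  have good_of : ∀ z P v (hz : z ∈ U v) g,
      (τ v₀ h₀ ≫ P ≫ I v z _ hz (hy v ⟨z, hz⟩) ≫ inv (τ v ⟨z, hz⟩)) =
        (f v₀)⁻¹ * φ g * f v → good z P := by
    intro z P v hz g h w hzw
    have hvw : A v w := ⟨z, hz, hzw⟩
    refine ⟨g * c v w, ?_⟩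
    have h2 := hc' v w hvw
    rw [hφ v w hvw, he v w hvw z hz hzw] at h2
    have : (f v₀)⁻¹ * φ (g * c v w) * f w =
        ((f v₀)⁻¹ * φ g * f v) * ((f v)⁻¹ * φ (c v w) * f w) := by
      rw [map_mul]; group
    rw [this, h2, ← h, mul_def]
    have h3 : I v z _ hz (hyl hvw) ≫ I v _ z (hyl hvw) hz = 𝟙 _ := by rw [I_comp, I_self]
    simp [reassoc_of% h3]
  have good_step : ∀ z z' P v (δ : Path z z'), (∀ t, δ t ∈ U v) → good z P →
      good z' (P ≫ Path.Homotopic.Quotient.mk δ) := by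
    intro z z' P v δ hδ hP
    have hz : z ∈ U v := by simpa using hδ 0
    have hz' : z' ∈ U v := by simpa using hδ 1
    obtain ⟨g, hg⟩ := hP v hz
    refine good_of _ _ v hz' g ?_
    rw [← hg, ← innerClass_eq_mk (hsc v ⟨z, hz⟩) hz hz' δ hδ, ← hI v z z' hz hz', Category.assoc,
      ← Category.assoc (I v z z' hz hz'), I_comp]
  have good_start : good (y v₀) (𝟙 _) := by
    refine good_of _ _ v₀ hy₀ 1 ?_
    rw [I_self]
    simp [one_def]
  let ψ : G →* (FundamentalGroupoid.mk (y v₀) ⟶ .mk (y v₀)) :=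
    (MulAut.conj (f v₀)⁻¹).toMonoidHom.comp φ
  have hψ : ∀ g, ψ g = (f v₀)⁻¹ * φ g * f v₀ := fun g => by simp [ψ]
  have hψi : Injective ψ := by
    rw [injective_iff_map_eq_one]
    intro g hg
    obtain ⟨_, P, hP, hP'⟩ := walk v₀ g (gen g)
    have h1 : τ v₀ h₀ ≫ P ≫ inv (τ v₀ h₀) = 𝟙 _ :=
      hP.trans ((hψ g).symm.trans hg)
    have h2 : P = 𝟙 _ := by
      have := congrArg (fun q => inv (τ v₀ h₀) ≫ q ≫ τ v₀ h₀) h1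
      simpa using this
    rw [h2, ← I_self v₀ _ hy₀, hFI v₀ v₀ _ _ hy₀ hy₀ hy₀, hc1 v₀ h₀, one_mul] at hP'
    exact hP'.symm
  have hψs : Surjective ψ := by
    intro q
    obtain ⟨g, hg⟩ := comp_induction_of_open_cover hU hcover good good_step (𝟙 _) good_start
      (inv (τ v₀ h₀) ≫ q ≫ τ v₀ h₀) v₀ hy₀
    refine ⟨g, ?_⟩
    rw [hψ, ← hg, I_self]
    simp
  let inversion : FundamentalGroup Y (y v₀) ≃* (FundamentalGroupoid.mk (y v₀) ⟶ .mk (y v₀)) :=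
    { toFun := fun p => inv p
      invFun := fun p => inv p
      left_inv := fun p => IsIso.inv_inv
      right_inv := fun p => IsIso.inv_inv
      map_mul' := fun p q => IsIso.inv_comp }
  exact ⟨inversion.trans (MulEquiv.ofBijective ψ ⟨hψi, hψs⟩).symm⟩

end FundamentalGroupOfCover

section RipsStars

variable {X : Set (EuclideanSpace ℝ (Fin 4))} {T : Finset (EuclideanSpace ℝ (Fin 4))}

/-- The uniform probability weight on a finite set of points. -/
noncomputable def uniformWeight (T : Finset (EuclideanSpace ℝ (Fin 4)))
    (p : EuclideanSpace ℝ (Fin 4)) : ℝ :=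
  open Classical in if p ∈ T then (T.card : ℝ)⁻¹ else 0

theorem uniformWeight_pos {p : EuclideanSpace ℝ (Fin 4)} (hp : p ∈ T) :
    0 < uniformWeight T p := by
  have : 0 < (T.card : ℝ) := by exact_mod_cast Finset.card_pos.2 ⟨p, hp⟩
  simpa [uniformWeight, hp] using this

theorem uniformWeight_nonneg (p : EuclideanSpace ℝ (Fin 4)) : 0 ≤ uniformWeight T p := by
  unfold uniformWeight
  split_ifs <;> positivity

theorem support_uniformWeight : support (uniformWeight T) = T := by
  ext p
  by_cases hp : p ∈ T
  · simp [hp, (uniformWeight_pos hp).ne']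
  · simp [uniformWeight, hp]

theorem finsum_uniformWeight (hT : T.Nonempty) : ∑ᶠ p, uniformWeight T p = 1 := by
  rw [finsum_eq_sum_of_support_subset _ support_uniformWeight.subset]
  have : (T.card : ℝ) ≠ 0 := by exact_mod_cast hT.card_ne_zero
  simp [uniformWeight, this]

theorem uniformWeight_mem_ripsRealization (hT : T.Nonempty)
    (hX : (T : Set (EuclideanSpace ℝ (Fin 4))) ⊆ X)
    (hd : diam (T : Set (EuclideanSpace ℝ (Fin 4))) < 1) :
    uniformWeight T ∈ ripsRealization X := by
  refine ⟨uniformWeight_nonneg, ?_, ?_, ?_, finsum_uniformWeight hT⟩ <;>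
    rw [support_uniformWeight]
  exacts [T.finite_toSet, hX, hd]

/-- The open star of a simplex is star-convex with respect to its barycentre. -/
theorem starConvex_openStar (hT : T.Nonempty) :
    StarConvex ℝ (uniformWeight T) {f | f ∈ ripsRealization X ∧ ∀ p ∈ T, 0 < f p} := by
  rintro f ⟨⟨h0, hfin, hX, hd, h1⟩, hf⟩ a b ha hb hab
  have hTf : (T : Set (EuclideanSpace ℝ (Fin 4))) ⊆ support f := fun p hp => (hf p hp).ne'
  have hsub : support (a • uniformWeight T + b • f) ⊆ support f := by
    intro p hp
    by_contra hpf
    have hpT : p ∉ support (uniformWeight T) := by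
      rw [support_uniformWeight]
      exact fun h => hpf (hTf h)
    rw [notMem_support] at hpf hpT
    simp [hpf, hpT] at hp
  refine ⟨⟨fun p => ?_, hfin.subset hsub, hsub.trans hX,
    (diam_mono hsub hfin.isBounded).trans_lt hd, ?_⟩, fun p hp => ?_⟩
  · have := uniformWeight_nonneg (T := T) p
    have := h0 p
    simp only [Pi.add_apply, Pi.smul_apply, smul_eq_mul]
    positivity
  · simp only [Pi.add_apply, Pi.smul_apply]
    rw [finsum_add_distrib, ← smul_finsum, ← smul_finsum, h1, finsum_uniformWeight hT]
    · simpa using hab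
    · refine T.finite_toSet.subset fun p hp => ?_
      rw [← support_uniformWeight]
      intro h
      simp [h] at hp
    · refine hfin.subset fun p hp h => ?_
      simp [h] at hp
  · have h2 := uniformWeight_pos hp
    have h3 := hf p hp
    simp only [Pi.add_apply, Pi.smul_apply, smul_eq_mul]
    rcases ha.eq_or_lt with rfl | ha
    · obtain rfl : b = 1 := by linarith
      simpa using h3
    · positivity

theorem isSimplyConnected_openStar (hT : T.Nonempty)
    (hne : {f : ripsRealization X | ∀ p ∈ T, 0 < f.1 p}.Nonempty) :
    IsSimplyConnected {f : ripsRealization X | ∀ p ∈ T, 0 < f.1 p} := by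
  rw [← Topology.IsEmbedding.subtypeVal.isSimplyConnected_image]
  have : Subtype.val '' {f : ripsRealization X | ∀ p ∈ T, 0 < f.1 p} =
      {f | f ∈ ripsRealization X ∧ ∀ p ∈ T, 0 < f p} := by
    ext f
    constructor
    · rintro ⟨g, hg, rfl⟩
      exact ⟨g.2, hg⟩
    · rintro ⟨hf, hf'⟩
      exact ⟨⟨f, hf⟩, hf', rfl⟩
  rw [this]
  have := (starConvex_openStar (X := X) hT).contractibleSpace (this ▸ hne.image _)
  exact inferInstanceAs (SimplyConnectedSpace _)

/-- The fundamental group of a Rips complex is the group classifying cocycles on its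
adjacency relation. -/
theorem exists_ripsRealization_fundamentalGroup_mulEquiv {V G : Type} [Group G] (S : Set V)
    (hS : S.Finite) (pt : V → EuclideanSpace ℝ (Fin 4)) (A : V → V → Prop)
    (hA : ∀ u v, A u v ↔ u ∈ S ∧ v ∈ S ∧ dist (pt u) (pt v) < 1)
    (c : V → V → G) (hc : IsCocycle A c)
    (univ : ∀ (H : Type) [Group H] (c' : V → V → H), IsCocycle A c' →
      ∃ (φ : G →* H) (f : V → H), ∀ u v, A u v → c' u v = (f u)⁻¹ * φ (c u v) * f v)
    (v₀ : V) (hv₀ : v₀ ∈ S) (gen : ∀ g, LabelledReach A c v₀ v₀ g)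
    (conn : ∀ v ∈ S, ∃ g, LabelledReach A c v₀ v g) :
    ∃ X : Set (EuclideanSpace ℝ (Fin 4)), X.Finite ∧
      ∃ x : ripsRealization X, Nonempty (FundamentalGroup (ripsRealization X) x ≃* G) := by
  classical
  set X := pt '' S with hX
  let U : V → Set (ripsRealization X) := fun v => {f | v ∈ S ∧ 0 < f.1 (pt v)}
  have hU1 : ∀ v ∈ S, U v = {f : ripsRealization X | ∀ p ∈ ({pt v} : Finset _), 0 < f.1 p} := by
    intro v hv
    ext f
    simp [U, hv]
  have hU2 : ∀ u ∈ S, ∀ v ∈ S, U u ∩ U v =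
      {f : ripsRealization X | ∀ p ∈ ({pt u, pt v} : Finset _), 0 < f.1 p} := by
    intro u hu v hv
    ext f
    simp [U, hu, hv]
  have hne : ∀ u v w, A u v → A v w → A u w → (U u ∩ U v ∩ U w).Nonempty := by
    intro u v w huv hvw huw
    rw [hA] at huv hvw huw
    refine ⟨⟨uniformWeight {pt u, pt v, pt w}, uniformWeight_mem_ripsRealization (by simp) ?_ ?_⟩,
      ⟨⟨huv.1, uniformWeight_pos (by simp)⟩, ⟨hvw.1, uniformWeight_pos (by simp)⟩⟩,
      ⟨hvw.2.1, uniformWeight_pos (by simp)⟩⟩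
    · simp only [Finset.coe_insert, Finset.coe_singleton, Set.insert_subset_iff,
        Set.singleton_subset_iff, hX]
      exact ⟨Set.mem_image_of_mem _ huv.1, Set.mem_image_of_mem _ hvw.1,
        Set.mem_image_of_mem _ hvw.2.1⟩
    · simp [diam_triple, huv.2.2, hvw.2.2, huw.2.2]
  have hAself : ∀ v ∈ S, A v v := fun v hv => (hA v v).2 ⟨hv, hv, by simp⟩
  have hAU : A = fun u v => (U u ∩ U v).Nonempty := by
    ext u v
    constructor
    · intro h
      exact (hne u v v h (hAself v ((hA u v).1 h).2.1) h).mono Set.inter_subset_left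
    · rintro ⟨⟨f, hf⟩, ⟨hu, hfu⟩, ⟨hv, hfv⟩⟩
      exact (hA u v).2 ⟨hu, hv, (dist_le_diam_of_mem hf.2.1.isBounded hfu.ne' hfv.ne').trans_lt
        hf.2.2.2.1⟩
  subst hAU
  refine ⟨X, hS.image _, ?_⟩
  obtain ⟨y, ⟨hy, -⟩, -⟩ := hne v₀ v₀ v₀ (hAself _ hv₀) (hAself _ hv₀) (hAself _ hv₀)
  refine ⟨y, nonempty_fundamentalGroup_mulEquiv_of_cover U ?_ ?_ ?_ ?_ hne c hc univ v₀ gen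
    (fun v ⟨f, hf⟩ => conn v hf.1) y hy⟩
  · intro v
    have hcont : Continuous fun f : ripsRealization X => f.1 (pt v) :=
      (continuous_apply (pt v)).comp continuous_subtype_val
    exact IsOpen.and isOpen_const (isOpen_lt continuous_const hcont)
  · rintro ⟨f, hf⟩
    obtain ⟨p, hp⟩ : ∃ p, f p ≠ 0 := by
      by_contra! h
      simpa [h] using hf.2.2.2.2
    obtain ⟨v, hv, rfl⟩ := hf.2.2.1 hp
    exact ⟨v, hv, (hf.1 _).lt_of_ne' hp⟩
  · intro v hv
    obtain ⟨f, hf⟩ := id hv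
    rw [hU1 v hf.1] at hv ⊢
    exact isSimplyConnected_openStar (by simp) hv
  · intro u v h
    obtain ⟨f, hfu, hfv⟩ := id h
    rw [hU2 u hfu.1 v hfv.1] at h ⊢
    exact (isSimplyConnected_openStar (by simp) h).isPathConnected

end RipsStars

section LabelledGraphs

variable {V G : Type} [Group G] {A : V → V → Prop} {c : V → V → G}

theorem LabelledReach.trans {u v w : V} {g h : G} (huv : LabelledReach A c u v g)
    (hvw : LabelledReach A c v w h) : LabelledReach A c u w (g * h) := by
  induction hvw with
  | refl => simpa using huv
  | step _ h ih => simpa [mul_assoc] using ih.step h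

theorem LabelledReach.single {u v : V} (h : A u v) : LabelledReach A c u v (c u v) := by
  simpa using (LabelledReach.refl (c := c)).step h

theorem LabelledReach.map {V' G' : Type} [Group G'] {A' : V' → V' → Prop} {c' : V' → V' → G'}
    (i : V → V') (φ : G →* G') (h : ∀ u v, A u v → A' (i u) (i v) ∧ c' (i u) (i v) = φ (c u v))
    {u v : V} {g : G} (huv : LabelledReach A c u v g) :
    LabelledReach A' c' (i u) (i v) (φ g) := by
  induction huv with
  | refl => simpa using LabelledReach.refl
  | step _ hvw ih =>
    rw [map_mul, ← (h _ _ hvw).2]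
    exact ih.step (h _ _ hvw).1

theorem IsCocycle.self (hc : IsCocycle A c) {u : V} (h : A u u) : c u u = 1 := by
  simpa using hc u u u h h h

theorem IsCocycle.symm (hc : IsCocycle A c) {u v : V} (huv : A u v) (hvu : A v u) (hu : A u u) :
    c v u = (c u v)⁻¹ := by
  have := hc u v u huv hvu hu
  rw [hc.self hu] at this
  exact eq_inv_of_mul_eq_one_right this

theorem LabelledReach.inv (hc : IsCocycle A c) (hA : ∀ u v, A u v → A v u ∧ A u u) {u v : V}
    {g : G} (huv : LabelledReach A c u v g) : LabelledReach A c v u g⁻¹ := by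
  induction huv with
  | refl => simpa using LabelledReach.refl
  | step _ hvw ih =>
    rw [mul_inv_rev, ← hc.symm hvw (hA _ _ hvw).1 (hA _ _ hvw).2]
    exact (LabelledReach.single (hA _ _ hvw).1).trans ih

end LabelledGraphs

/-- A graph with labels in `F` classifying its cocycles, a projection of `F` onto a quotient `G`,
and a track, i.e. a walk through the graph recording the product of the labels passed so far, whose
returns to the base vertex generate the relations defining `G`. -/
structure LabelledTrack (N F G : Type) [Group F] [Group G] where
  adj : N → N → Prop
  label : N → N → F
  proj : F →* G
  base : N
  length : ℕ
  height : ℕ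
  pos : ℕ → N
  word : ℕ → F
  adj_symm : ∀ u v, adj u v → adj v u
  adj_self : ∀ u v, adj u v → adj u u
  isCocycle_label : IsCocycle adj label
  classify : ∀ (H : Type) [Group H] (c : N → N → H), IsCocycle adj c →
    ∃ (φ : F →* H) (f : N → H), ∀ u v, adj u v → c u v = (f u)⁻¹ * φ (label u v) * f v
  adj_base : adj base base
  reach_base : ∀ g, LabelledReach adj label base base g
  exists_reach : ∀ u, adj u u → ∃ g, LabelledReach adj label base u g
  proj_surjective : Surjective proj
  two_le_height : 2 ≤ height
  pos_zero : pos 0 = base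
  word_zero : word 0 = 1
  adj_pos : ∀ s ≤ length, adj (pos s) (pos s)
  adj_pos_succ : ∀ s < length, adj (pos s) (pos (s + 1))
  word_succ : ∀ s < length, word (s + 1) = word s * label (pos s) (pos (s + 1))
  proj_word : ∀ s ≤ length, adj base (pos s) → proj (word s) = proj (label base (pos s))
  lift : ∀ (H : Type) [Group H] (φ : F →* H),
    (∀ s ≤ length, pos s = base → φ (word s) = 1) → ∃ φ' : G →* H, ∀ x, φ' (proj x) = φ x

namespace LabelledTrack

variable {N F G : Type} [Group F] [Group G] (D : LabelledTrack N F G)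

/-- The vertices `(u, s, t)` of the complex built from the track: the product of the graph with a
segment in the direction `s`, to which the track and the base line are attached in the direction
`t`. -/
def vertices : Set (N × ℕ × ℕ) :=
  {v | D.adj v.1 v.1 ∧ v.2.1 ≤ D.length ∧ v.2.2 ≤ D.height ∧
    (v.2.2 = 0 ∨ v.1 = D.base ∨ v.1 = D.pos v.2.1)}

/-- Adjacency in the complex built from the track. At the top level, the track and the base line
are glued together. -/
def Adj (v w : N × ℕ × ℕ) : Prop :=
  v ∈ D.vertices ∧ w ∈ D.vertices ∧ (v.2.1 ≤ w.2.1 + 1 ∧ w.2.1 ≤ v.2.1 + 1) ∧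
    (v.2.2 ≤ w.2.2 + 1 ∧ w.2.2 ≤ v.2.2 + 1) ∧
    (D.adj v.1 w.1 ∨ (v.1 = D.base ∧ w.2.2 = D.height) ∨ (w.1 = D.base ∧ v.2.2 = D.height))

open Classical in
/-- The element of `G` read off at a vertex of positive height. -/
noncomputable def value (v : N × ℕ × ℕ) : G :=
  if v.1 = D.base then 1 else D.proj (D.word v.2.1)

/-- The tautological cocycle on the complex built from the track. -/
noncomputable def cocycle (v w : N × ℕ × ℕ) : G :=
  if 1 ≤ v.2.2 ∧ 1 ≤ w.2.2 then (D.value v)⁻¹ * D.value w else D.proj (D.label v.1 w.1)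

variable {D}

theorem Adj.symm {v w : N × ℕ × ℕ} (h : D.Adj v w) : D.Adj w v := by
  obtain ⟨h1, h2, h3, h4, h5⟩ := h
  refine ⟨h2, h1, h3.symm, h4.symm, ?_⟩
  rcases h5 with h | h | h
  exacts [Or.inl (D.adj_symm _ _ h), Or.inr (Or.inr h), Or.inr (Or.inl h)]

theorem Adj.self {v w : N × ℕ × ℕ} (h : D.Adj v w) : D.Adj v v :=
  ⟨h.1, h.1, by omega, by omega, Or.inl h.1.1⟩

theorem label_base : D.label D.base D.base = 1 := D.isCocycle_label.self D.adj_base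

theorem label_symm {u v : N} (h : D.adj u v) : D.label v u = (D.label u v)⁻¹ :=
  D.isCocycle_label.symm h (D.adj_symm _ _ h) (D.adj_self _ _ h)

theorem proj_word_of_pos_eq_base {s : ℕ} (hs : s ≤ D.length) (h : D.pos s = D.base) :
    D.proj (D.word s) = 1 := by
  rw [D.proj_word s hs (h ▸ D.adj_base), h, label_base, map_one]

theorem value_of_eq_pos {v : N × ℕ × ℕ} (hs : v.2.1 ≤ D.length) (h : v.1 = D.pos v.2.1) :
    D.value v = D.proj (D.word v.2.1) := by
  unfold value
  split_ifs with hb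
  · rw [proj_word_of_pos_eq_base hs (h ▸ hb)]
  · rfl

theorem value_of_eq_base {v : N × ℕ × ℕ} (h : v.1 = D.base) : D.value v = 1 := if_pos h

theorem proj_label_pos_succ {s : ℕ} (hs : s < D.length) :
    D.proj (D.label (D.pos s) (D.pos (s + 1))) =
      (D.proj (D.word s))⁻¹ * D.proj (D.word (s + 1)) := by
  rw [D.word_succ s hs, map_mul, inv_mul_cancel_left]

theorem cocycle_eq_of_adj {v w : N × ℕ × ℕ} (h : D.Adj v w) (hvw : D.adj v.1 w.1) :
    D.cocycle v w = D.proj (D.label v.1 w.1) := by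
  unfold cocycle
  split_ifs with ht
  · obtain ⟨⟨-, hv, -, hv'⟩, ⟨-, hw, -, hw'⟩, hs, -⟩ := h
    rcases hv' with h0 | hv' | hv'
    · omega
    · rcases hw' with h0 | hw' | hw'
      · omega
      · rw [value_of_eq_base hv', value_of_eq_base hw', hv', hw', label_base]
        simp
      · rw [value_of_eq_base hv', value_of_eq_pos hw hw', hv', hw', ← D.proj_word _ hw]
        · simp
        · rwa [← hv', ← hw']
    · rcases hw' with h0 | hw' | hw'
      · omega
      · rw [value_of_eq_base hw', value_of_eq_pos hv hv', label_symm (D.adj_symm _ _ hvw), hv', hw',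
          map_inv, ← D.proj_word _ hv]
        · simp
        · rw [← hv', ← hw']
          exact D.adj_symm _ _ hvw
      · rw [value_of_eq_pos hv hv', value_of_eq_pos hw hw', hv', hw']
        obtain hst | hst | hst : w.2.1 = v.2.1 + 1 ∨ v.2.1 = w.2.1 + 1 ∨ v.2.1 = w.2.1 := by omega
        · rw [hst, proj_label_pos_succ (by omega)]
        · rw [hst, label_symm (D.adj_pos_succ _ (by omega)), map_inv,
            proj_label_pos_succ (by omega)]
          simp
        · rw [hst, D.isCocycle_label.self (D.adj_pos _ hw)]
          simp
  · rfl

theorem isCocycle_cocycle : IsCocycle D.Adj D.cocycle := by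
  intro u v w huv hvw huw
  have hT := D.two_le_height
  by_cases ht : 1 ≤ u.2.2 ∧ 1 ≤ v.2.2 ∧ 1 ≤ w.2.2
  · simp [cocycle, ht, mul_assoc]
  · have key : ∀ {a b}, D.Adj a b → a.2.2 ≤ 1 → b.2.2 ≤ 1 → D.adj a.1 b.1 := by
      rintro a b ⟨-, -, -, -, h | h | h⟩ ha hb
      exacts [h, by omega, by omega]
    have h1 := huv.2.2.2.1
    have h2 := hvw.2.2.2.1
    have h3 := huw.2.2.2.1
    have kuv := key huv (by omega) (by omega)
    have kvw := key hvw (by omega) (by omega)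
    have kuw := key huw (by omega) (by omega)
    rw [cocycle_eq_of_adj huv kuv, cocycle_eq_of_adj hvw kvw, cocycle_eq_of_adj huw kuw,
      ← map_mul, D.isCocycle_label _ _ _ kuv kvw kuw]

theorem mem_vertices_zero {u : N} {s : ℕ} (hu : D.adj u u) (hs : s ≤ D.length) :
    (u, s, 0) ∈ D.vertices :=
  ⟨hu, hs, Nat.zero_le _, Or.inl rfl⟩

theorem mem_vertices_of_succ {u : N} {s t : ℕ} (h : (u, s, t + 1) ∈ D.vertices) :
    (u, s, t) ∈ D.vertices :=
  ⟨h.1, h.2.1, (Nat.le_succ t).trans h.2.2.1, Or.inr (h.2.2.2.resolve_left (Nat.succ_ne_zero t))⟩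

theorem adj_succ_left {u : N} {s t : ℕ} (h : (u, s + 1, t) ∈ D.vertices)
    (h' : (u, s, t) ∈ D.vertices) : D.Adj (u, s, t) (u, s + 1, t) :=
  ⟨h', h, ⟨by dsimp only; omega, le_rfl⟩, ⟨Nat.le_succ t, Nat.le_succ t⟩, Or.inl h.1⟩

theorem adj_succ_right {u : N} {s t : ℕ} (h : (u, s, t + 1) ∈ D.vertices) :
    D.Adj (u, s, t) (u, s, t + 1) :=
  ⟨mem_vertices_of_succ h, h, ⟨Nat.le_succ s, Nat.le_succ s⟩, ⟨by dsimp only; omega, le_rfl⟩,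
    Or.inl h.1⟩

theorem adj_zero_zero {u v : N} (h : D.adj u v) : D.Adj (u, 0, 0) (v, 0, 0) :=
  ⟨mem_vertices_zero (D.adj_self _ _ h) (Nat.zero_le _),
    mem_vertices_zero (D.adj_self _ _ (D.adj_symm _ _ h)) (Nat.zero_le _), by simp, by simp,
    Or.inl h⟩

theorem reach_zero_zero {u v : N} {x : F} (h : LabelledReach D.adj D.label u v x) :
    LabelledReach D.Adj D.cocycle (u, 0, 0) (v, 0, 0) (D.proj x) :=
  h.map (fun u => (u, 0, 0)) D.proj fun _ _ h => ⟨adj_zero_zero h, by simp [cocycle]⟩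

theorem reach_cocycle_base (g : G) :
    LabelledReach D.Adj D.cocycle (D.base, 0, 0) (D.base, 0, 0) g := by
  obtain ⟨x, rfl⟩ := D.proj_surjective g
  exact reach_zero_zero (D.reach_base x)

theorem exists_reach_cocycle {v : N × ℕ × ℕ} (hv : v ∈ D.vertices) :
    ∃ g, LabelledReach D.Adj D.cocycle (D.base, 0, 0) v g := by
  obtain ⟨u, s, t⟩ := v
  induction t with
  | zero =>
    induction s with
    | zero =>
      obtain ⟨x, hx⟩ := D.exists_reach u hv.1
      exact ⟨_, reach_zero_zero hx⟩
    | succ s ih =>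
      have hv' : (u, s, 0) ∈ D.vertices := mem_vertices_zero hv.1 ((Nat.le_succ s).trans hv.2.1)
      obtain ⟨g, hg⟩ := ih hv'
      exact ⟨_, hg.step (adj_succ_left hv hv')⟩
  | succ t ih =>
    obtain ⟨g, hg⟩ := ih (mem_vertices_of_succ hv)
    exact ⟨_, hg.step (adj_succ_right hv)⟩

/-- The gauge making a cocycle trivial in the directions `s` (at height zero) and `t`. -/
def gauge {H : Type} [Group H] (c : N × ℕ × ℕ → N × ℕ × ℕ → H) (f : N → H) (u : N) (s : ℕ) :
    ℕ → H
  | 0 => Nat.rec (f u) (fun s x => x * c (u, s, 0) (u, s + 1, 0)) s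
  | t + 1 => gauge c f u s t * c (u, s, t) (u, s, t + 1)

section Classification

variable {H : Type} [Group H] {d : N × ℕ × ℕ → N × ℕ × ℕ → H} {φ : F →* H}

theorem eq_of_triangle_right (hd : IsCocycle D.Adj d) {v w w' : N × ℕ × ℕ} (h : D.Adj v w)
    (h' : D.Adj v w') (hw : D.Adj w w') (h1 : d w w' = 1) : d v w' = d v w := by
  rw [← hd v w w' h hw h', h1, mul_one]

theorem eq_of_triangle_left (hd : IsCocycle D.Adj d) {v v' w : N × ℕ × ℕ} (h : D.Adj v w)
    (h' : D.Adj v' w) (hv : D.Adj v v') (h1 : d v v' = 1) : d v' w = d v w := by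
  rw [← hd v v' w hv h' h, h1, one_mul]

theorem eq_label_of_adj (hd : IsCocycle D.Adj d)
    (h0 : ∀ u v, D.adj u v → d (u, 0, 0) (v, 0, 0) = φ (D.label u v))
    (hs : ∀ u s, D.Adj (u, s, 0) (u, s + 1, 0) → d (u, s, 0) (u, s + 1, 0) = 1)
    (ht : ∀ u s t, D.Adj (u, s, t) (u, s, t + 1) → d (u, s, t) (u, s, t + 1) = 1)
    {v w : N × ℕ × ℕ} (h : D.Adj v w) (hvw : D.adj v.1 w.1) : d v w = φ (D.label v.1 w.1) := by
  have level_zero : ∀ s ≤ D.length, ∀ u v, D.adj u v →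
      d (u, s, 0) (v, s, 0) = φ (D.label u v) := by
    intro s hsl u v huv
    have hu := D.adj_self _ _ huv
    have hv := D.adj_self _ _ (D.adj_symm _ _ huv)
    induction s with
    | zero => exact h0 u v huv
    | succ s ih =>
      have hu0 := mem_vertices_zero hu (Nat.le_of_succ_le hsl)
      have hv0 := mem_vertices_zero hv (Nat.le_of_succ_le hsl)
      have hu1 := mem_vertices_zero hu hsl
      have hv1 := mem_vertices_zero hv hsl
      have e1 := adj_succ_left hu1 hu0
      have e2 := adj_succ_left hv1 hv0
      have e3 : D.Adj (u, s, 0) (v, s + 1, 0) := ⟨hu0, hv1, by dsimp only; omega, by simp,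
        Or.inl huv⟩
      rw [eq_of_triangle_left hd e3 ⟨hu1, hv1, by simp, by simp, Or.inl huv⟩ e1 (hs _ _ e1),
        eq_of_triangle_right hd ⟨hu0, hv0, by simp, by simp, Or.inl huv⟩ e3 e2 (hs _ _ e2),
        ih (Nat.le_of_succ_le hsl)]
  have swap : ∀ {v w}, D.Adj v w → D.adj v.1 w.1 → d v w = φ (D.label v.1 w.1) →
      d w v = φ (D.label w.1 v.1) := by
    intro v w h hvw e
    rw [hd.symm h h.symm h.self, e, label_symm hvw, map_inv]
  have level : ∀ t u s u' s', D.Adj (u, s, t) (u', s', t) → D.adj u u' →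
      d (u, s, t) (u', s', t) = φ (D.label u u') := by
    intro t
    induction t with
    | zero =>
      have up : ∀ u s u', D.Adj (u, s, 0) (u', s + 1, 0) → D.adj u u' →
          d (u, s, 0) (u', s + 1, 0) = φ (D.label u u') := by
        intro u s u' h huv
        have hm := mem_vertices_zero (D.adj_self _ _ (D.adj_symm _ _ huv)) h.1.2.1
        have e := adj_succ_left h.2.1 hm
        rw [eq_of_triangle_right hd ⟨h.1, hm, by simp, by simp, Or.inl huv⟩ h e (hs _ _ e),
          level_zero s h.1.2.1 u u' huv]
      intro u s u' s' h huv
      have hss := h.2.2.1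
      dsimp only at hss
      obtain rfl | rfl | rfl : s' = s + 1 ∨ s = s' + 1 ∨ s = s' := by omega
      · exact up u s u' h huv
      · exact swap h.symm (D.adj_symm _ _ huv) (up u' s' u h.symm (D.adj_symm _ _ huv))
      · exact level_zero s h.1.2.1 u u' huv
    | succ t ih =>
      intro u s u' s' h huv
      have e1 := adj_succ_right h.1
      have e2 := adj_succ_right h.2.1
      have e3 : D.Adj (u, s, t) (u', s', t + 1) :=
        ⟨e1.1, h.2.1, h.2.2.1, by dsimp only; omega, Or.inl huv⟩
      have e4 : D.Adj (u, s, t) (u', s', t) := ⟨e1.1, e2.1, h.2.2.1, by simp, Or.inl huv⟩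
      rw [eq_of_triangle_left hd e3 h e1 (ht _ _ _ e1),
        eq_of_triangle_right hd e4 e3 e2 (ht _ _ _ e2), ih u s u' s' e4 huv]
  have up : ∀ u s u' s' t, D.Adj (u, s, t) (u', s', t + 1) → D.adj u u' →
      d (u, s, t) (u', s', t + 1) = φ (D.label u u') := by
    intro u s u' s' t h huv
    have e := adj_succ_right h.2.1
    have e' : D.Adj (u, s, t) (u', s', t) := ⟨h.1, e.1, h.2.2.1, by simp, Or.inl huv⟩
    rw [eq_of_triangle_right hd e' h e (ht _ _ _ e), level t u s u' s' e' huv]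
  obtain ⟨u, s, t⟩ := v
  obtain ⟨u', s', t'⟩ := w
  have htt := h.2.2.2.1
  dsimp only at htt hvw ⊢
  obtain rfl | rfl | rfl : t' = t + 1 ∨ t = t' + 1 ∨ t = t' := by omega
  · exact up _ _ _ _ _ h hvw
  · exact swap h.symm (D.adj_symm _ _ hvw) (up _ _ _ _ _ h.symm (D.adj_symm _ _ hvw))
  · exact level _ _ _ _ _ h hvw

theorem pos_mem_vertices {s : ℕ} (hs : s ≤ D.length) : (D.pos s, s, D.height) ∈ D.vertices :=
  ⟨D.adj_pos s hs, hs, le_rfl, Or.inr (Or.inr rfl)⟩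

theorem base_mem_vertices {s t : ℕ} (hs : s ≤ D.length) (ht : t ≤ D.height) :
    (D.base, s, t) ∈ D.vertices :=
  ⟨D.adj_base, hs, ht, Or.inr (Or.inl rfl)⟩

theorem adj_base_pos {s s' : ℕ} (hs : s ≤ D.length) (hs' : s' ≤ D.length) (h1 : s ≤ s' + 1)
    (h2 : s' ≤ s + 1) : D.Adj (D.base, s, D.height) (D.pos s', s', D.height) :=
  ⟨base_mem_vertices hs le_rfl, pos_mem_vertices hs', ⟨h1, h2⟩, by simp, Or.inr (Or.inl ⟨rfl, rfl⟩)⟩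

theorem eq_word (hd : IsCocycle D.Adj d)
    (hl : ∀ {v w}, D.Adj v w → D.adj v.1 w.1 → d v w = φ (D.label v.1 w.1))
    {s : ℕ} (hs : s ≤ D.length) :
    d (D.base, s, D.height) (D.pos s, s, D.height) = φ (D.word s) := by
  induction s with
  | zero =>
    rw [hl (adj_base_pos hs hs (by simp) (by simp)) (by simpa [D.pos_zero] using D.adj_base)]
    simp [D.pos_zero, D.word_zero, label_base]
  | succ s ih =>
    have hs' := Nat.le_of_succ_le hs
    have e1 : D.Adj (D.base, s, D.height) (D.base, s + 1, D.height) :=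
      adj_succ_left (base_mem_vertices hs le_rfl) (base_mem_vertices hs' le_rfl)
    have e2 : D.Adj (D.base, s, D.height) (D.pos (s + 1), s + 1, D.height) :=
      adj_base_pos hs' hs (by omega) (by omega)
    have e3 : D.Adj (D.pos s, s, D.height) (D.pos (s + 1), s + 1, D.height) :=
      ⟨pos_mem_vertices hs', pos_mem_vertices hs, by dsimp only; omega, by simp,
        Or.inl (D.adj_pos_succ s hs)⟩
    have e4 := adj_base_pos hs' hs' (by omega) (by omega)
    have e5 := adj_base_pos hs hs (by omega) (by omega)
    rw [eq_of_triangle_left hd e2 e5 e1, ← hd _ _ _ e4 e3 e2, ih hs', hl e3 (D.adj_pos_succ s hs),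
      D.word_succ s hs, map_mul]
    rw [hl e1 D.adj_base, label_base, map_one]

theorem exists_eq_cocycle (hd : IsCocycle D.Adj d)
    (hl : ∀ {v w}, D.Adj v w → D.adj v.1 w.1 → d v w = φ (D.label v.1 w.1)) :
    ∃ φ' : G →* H, ∀ v w, D.Adj v w → d v w = φ' (D.cocycle v w) := by
  obtain ⟨φ', hφ'⟩ := D.lift H φ (by
    intro s hs hb
    have e := adj_base_pos hs hs (by omega) (by omega)
    rw [← eq_word hd hl hs, hl e (by simpa [hb] using D.adj_base)]
    simp [hb, label_base])
  refine ⟨φ', ?_⟩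
  have hT := D.two_le_height
  have top : ∀ v w, D.Adj v w → v.1 = D.base → w.2.2 = D.height → d v w = φ' (D.cocycle v w) := by
    rintro ⟨u, s, t⟩ ⟨u', s', t'⟩ h rfl rfl
    obtain h0 | hb | hp := h.2.1.2.2.2
    · dsimp only at h0; omega
    · have : D.adj D.base u' := by
        dsimp only at hb
        exact hb ▸ D.adj_base
      rw [hl h this, cocycle_eq_of_adj h this, hφ']
    · dsimp only at hp
      subst hp
      have hs' := h.2.1.2.1
      have e2 := adj_base_pos hs' hs' (by omega) (by omega)
      have e1 : D.Adj (D.base, s, t) (D.base, s', D.height) :=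
        ⟨h.1, e2.1, h.2.2.1, h.2.2.2.1, Or.inl D.adj_base⟩
      have htt := h.2.2.2.1
      dsimp only at htt
      rw [← hd _ _ _ e1 e2 h, hl e1 D.adj_base, eq_word hd hl hs', cocycle, if_pos (by
        dsimp only; omega), value_of_eq_base rfl, value_of_eq_pos hs' rfl, label_base]
      simp [hφ']
  intro v w h
  obtain h1 | ⟨h1, h2⟩ | ⟨h1, h2⟩ := h.2.2.2.2
  · rw [hl h h1, cocycle_eq_of_adj h h1, hφ']
  · exact top v w h h1 h2
  · rw [hd.symm h.symm h h.symm.self, isCocycle_cocycle.symm h.symm h h.symm.self, map_inv,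
      top w v h.symm h1 h2]

end Classification

/-- Every cocycle on the complex built from a track is, up to a gauge, the image of the tautological
one under a homomorphism from `G`. -/
theorem classify_cocycle (H : Type) [Group H] (c : N × ℕ × ℕ → N × ℕ × ℕ → H)
    (hc : IsCocycle D.Adj c) : ∃ (φ : G →* H) (f : N × ℕ × ℕ → H),
      ∀ v w, D.Adj v w → c v w = (f v)⁻¹ * φ (D.cocycle v w) * f w := by
  obtain ⟨φ, β, h⟩ := D.classify H (fun u v => c (u, 0, 0) (v, 0, 0)) fun u v w h1 h2 h3 =>
    hc _ _ _ (adj_zero_zero h1) (adj_zero_zero h2) (adj_zero_zero h3)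
  let f : N × ℕ × ℕ → H := fun v => gauge c β v.1 v.2.1 v.2.2
  let d : N × ℕ × ℕ → N × ℕ × ℕ → H := fun v w => f v * c v w * (f w)⁻¹
  have hd : IsCocycle D.Adj d := by
    intro u v w h1 h2 h3
    simp only [d]
    rw [← hc u v w h1 h2 h3]
    group
  obtain ⟨φ', hφ'⟩ := exists_eq_cocycle hd (φ := φ) fun {v w} => eq_label_of_adj hd
    (fun u v huv => by
      change β u * c (u, 0, 0) (v, 0, 0) * (β v)⁻¹ = _
      rw [h u v huv]
      group)
    (fun u s _ => by
      simp only [d, f, gauge]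
      group)
    (fun u s t _ => by
      simp only [d, f, gauge]
      group)
  refine ⟨φ', f, fun v w hvw => ?_⟩
  rw [← hφ' v w hvw]
  simp only [d]
  group

end LabelledTrack

section Ladder

variable {m : ℕ}

/-- The vertices of the ladder: a bottom rail from `0` to `2 * m + 2` and a top rail from `2` to
`2 * m + 2`. -/
def ladderVertices (m : ℕ) : Set (Bool × ℕ) := {u | u.2 ≤ 2 * m + 2 ∧ (u.1 = true → 2 ≤ u.2)}

/-- Adjacency in the ladder, which has a rung at every even position of the top rail. -/
def ladderAdj (m : ℕ) (u v : Bool × ℕ) : Prop :=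
  u ∈ ladderVertices m ∧ v ∈ ladderVertices m ∧
    (u.1 = v.1 ∧ u.2 ≤ v.2 + 1 ∧ v.2 ≤ u.2 + 1 ∨ u.1 ≠ v.1 ∧ u.2 = v.2 ∧ Even u.2)

/-- The label of the rung at position `x`: the first rung is unlabelled, and the other ones are
labelled by the generators of the free group. -/
def ladderRung (m x : ℕ) : FreeGroup (Fin m) :=
  if h : 4 ≤ x ∧ (x - 4) / 2 < m then FreeGroup.of ⟨(x - 4) / 2, h.2⟩ else 1

/-- The labels of the ladder, which are trivial along the rails. -/
def ladderLabel (m : ℕ) (u v : Bool × ℕ) : FreeGroup (Fin m) :=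
  if u.1 = v.1 then 1 else if u.1 = false then ladderRung m u.2 else (ladderRung m u.2)⁻¹

/-- Adjacency in the part of the ladder which is not adjacent to the vertex `(false, 0)`. -/
def ladderFarAdj (m : ℕ) (u v : Bool × ℕ) : Prop := ladderAdj m u v ∧ 2 ≤ u.2 ∧ 2 ≤ v.2

theorem ladderAdj_symm (u v : Bool × ℕ) (h : ladderAdj m u v) : ladderAdj m v u := by
  obtain ⟨hu, hv, h | ⟨h1, h2, h3⟩⟩ := h
  · exact ⟨hv, hu, Or.inl ⟨h.1.symm, h.2.2, h.2.1⟩⟩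
  · exact ⟨hv, hu, Or.inr ⟨h1.symm, h2.symm, h2 ▸ h3⟩⟩

theorem ladderAdj_self_of_mem {u : Bool × ℕ} (h : u ∈ ladderVertices m) : ladderAdj m u u :=
  ⟨h, h, Or.inl ⟨rfl, Nat.le_succ _, Nat.le_succ _⟩⟩

theorem ladderAdj_self (u v : Bool × ℕ) (h : ladderAdj m u v) : ladderAdj m u u :=
  ladderAdj_self_of_mem h.1

theorem isCocycle_ladderLabel : IsCocycle (ladderAdj m) (ladderLabel m) := by
  rintro ⟨j, x⟩ ⟨k, y⟩ ⟨l, z⟩ ⟨-, -, h1⟩ ⟨-, -, h2⟩ ⟨-, -, h3⟩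
  dsimp only at h1 h2 h3
  cases j <;> cases k <;> cases l <;> simp_all [ladderLabel]

theorem ladderFarAdj_symm_self (u v : Bool × ℕ) (h : ladderFarAdj m u v) :
    ladderFarAdj m v u ∧ ladderFarAdj m u u :=
  ⟨⟨ladderAdj_symm _ _ h.1, h.2.symm⟩, ⟨ladderAdj_self _ _ h.1, h.2.1, h.2.1⟩⟩

theorem isCocycle_ladderLabel_far : IsCocycle (ladderFarAdj m) (ladderLabel m) :=
  fun u v w h1 h2 h3 => isCocycle_ladderLabel u v w h1.1 h2.1 h3.1

theorem ladderRung_two : ladderRung m 2 = 1 := by simp [ladderRung]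

theorem ladderRung_of (i : Fin m) : ladderRung m (2 * i + 4) = FreeGroup.of i := by
  simp [ladderRung]

theorem ladderAdj_rail {j : Bool} {x : ℕ} (h : (j, x) ∈ ladderVertices m) (hx : x < 2 * m + 2) :
    ladderAdj m (j, x) (j, x + 1) :=
  ⟨h, ⟨hx, fun hj => (h.2 hj).trans (Nat.le_succ x)⟩,
    Or.inl ⟨rfl, by dsimp only; omega, le_rfl⟩⟩

theorem ladderAdj_rung {x : ℕ} (h2 : 2 ≤ x) (hx : x ≤ 2 * m + 2) (he : Even x) :
    ladderAdj m (false, x) (true, x) :=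
  ⟨⟨hx, by simp⟩, ⟨hx, fun _ => h2⟩, Or.inr ⟨by simp, rfl, he⟩⟩

theorem ladderReach_rail (j : Bool) {x : ℕ} (h2 : 2 ≤ x) (hx : x ≤ 2 * m + 2) :
    LabelledReach (ladderFarAdj m) (ladderLabel m) (j, 2) (j, x) 1 := by
  induction x, h2 using Nat.le_induction with
  | base => exact .refl
  | succ x h2 ih =>
    have h : ladderFarAdj m (j, x) (j, x + 1) :=
      ⟨ladderAdj_rail ⟨by dsimp only; omega, fun _ => h2⟩ (by omega), h2, by dsimp only; omega⟩
    simpa [ladderLabel] using (ih (by omega)).step h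

theorem ladderReach_loop (g : FreeGroup (Fin m)) :
    LabelledReach (ladderFarAdj m) (ladderLabel m) (false, 2) (false, 2) g := by
  induction g using FreeGroup.induction_on with
  | C1 => exact .refl
  | of i =>
    have hi := i.isLt
    have h1 : ladderFarAdj m (false, 2 * i + 4) (true, 2 * i + 4) :=
      ⟨ladderAdj_rung (by omega) (by omega) ⟨i + 2, by omega⟩, by dsimp only; omega,
        by dsimp only; omega⟩
    have h2 : ladderFarAdj m (true, 2) (false, 2) :=
      ⟨ladderAdj_symm _ _ (ladderAdj_rung le_rfl (by omega) even_two), le_rfl, le_rfl⟩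
    have h3 := (ladderReach_rail (m := m) true (x := 2 * i + 4) (by omega) (by omega)).inv
      isCocycle_ladderLabel_far ladderFarAdj_symm_self
    have := (((ladderReach_rail (m := m) false (x := 2 * i + 4) (by omega) (by omega)).step
      h1).trans h3).step h2
    simpa [ladderLabel, ladderRung_two, ladderRung_of] using this
  | inv_of i ih => exact ih.inv isCocycle_ladderLabel_far ladderFarAdj_symm_self
  | mul x y hx hy => exact hx.trans hy

theorem LabelledReach.of_far {u v : Bool × ℕ} {g : FreeGroup (Fin m)}
    (h : LabelledReach (ladderFarAdj m) (ladderLabel m) u v g) :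
    LabelledReach (ladderAdj m) (ladderLabel m) u v g :=
  LabelledReach.map (A' := ladderAdj m) (c' := ladderLabel m) id (MonoidHom.id _)
    (fun _ _ h => ⟨h.1, rfl⟩) h

theorem ladderReach_base {x : ℕ} (hx : x ≤ 2 * m + 2) :
    LabelledReach (ladderAdj m) (ladderLabel m) (false, 0) (false, x) 1 := by
  induction x with
  | zero => exact .refl
  | succ x ih =>
    simpa [ladderLabel] using
      (ih (by omega)).step (ladderAdj_rail ⟨by dsimp only; omega, by simp⟩ (by omega))

theorem ladderReach_base_loop (g : FreeGroup (Fin m)) :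
    LabelledReach (ladderAdj m) (ladderLabel m) (false, 0) (false, 0) g := by
  have h := ladderReach_base (m := m) (x := 2) (by omega)
  simpa using (h.trans (ladderReach_loop g).of_far).trans
    (h.inv isCocycle_ladderLabel fun u v h => ⟨ladderAdj_symm u v h, ladderAdj_self u v h⟩)

theorem exists_ladderReach_base (u : Bool × ℕ) (hu : ladderAdj m u u) :
    ∃ g, LabelledReach (ladderAdj m) (ladderLabel m) (false, 0) u g := by
  obtain ⟨j, x⟩ := u
  cases j
  · exact ⟨1, ladderReach_base hu.1.1⟩
  · exact ⟨_, ((ladderReach_base (by omega)).step (ladderAdj_rung le_rfl (by omega) even_two)).trans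
      (ladderReach_rail true (hu.1.2 rfl) hu.1.1).of_far⟩

/-- The product of the values of a labelling along the rails of the ladder, the top rail being
reached through the first rung. -/
def ladderGauge {H : Type} [Group H] (c : Bool × ℕ → Bool × ℕ → H) : Bool × ℕ → H
  | (false, x) => Nat.rec 1 (fun y g => g * c (false, y) (false, y + 1)) x
  | (true, x) =>
      Nat.rec (1 * c (false, 0) (false, 1) * c (false, 1) (false, 2) * c (false, 2) (true, 2))
        (fun y g => g * c (true, y + 2) (true, y + 3)) (x - 2)

/-- Every cocycle on the ladder is, up to a gauge, the image of the labels under a homomorphism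
from the free group. -/
theorem ladder_classify (H : Type) [Group H] (c : Bool × ℕ → Bool × ℕ → H)
    (hc : IsCocycle (ladderAdj m) c) :
    ∃ (φ : FreeGroup (Fin m) →* H) (f : Bool × ℕ → H), ∀ u v, ladderAdj m u v →
      c u v = (f u)⁻¹ * φ (ladderLabel m u v) * f v := by
  let f := ladderGauge c
  let φ : FreeGroup (Fin m) →* H :=
    FreeGroup.lift fun i => f (false, 2 * i + 4) * c (false, 2 * i + 4) (true, 2 * i + 4) *
      (f (true, 2 * i + 4))⁻¹
  have swap : ∀ u v, ladderAdj m u v → c u v = (f u)⁻¹ * φ (ladderLabel m u v) * f v →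
      c v u = (f v)⁻¹ * φ (ladderLabel m v u) * f u := by
    intro u v h e
    rw [hc.symm h (ladderAdj_symm _ _ h) (ladderAdj_self _ _ h), e,
      isCocycle_ladderLabel.symm h (ladderAdj_symm _ _ h) (ladderAdj_self _ _ h), map_inv]
    group
  have rail : ∀ j x, ladderAdj m (j, x) (j, x + 1) → c (j, x) (j, x + 1) =
      (f (j, x))⁻¹ * φ (ladderLabel m (j, x) (j, x + 1)) * f (j, x + 1) := by
    intro j x h
    have hf : f (j, x + 1) = f (j, x) * c (j, x) (j, x + 1) := by
      cases j
      · rfl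
      · obtain ⟨y, rfl⟩ := Nat.exists_eq_add_of_le' (h.1.2 rfl)
        rfl
    rw [hf]
    simp [ladderLabel]
  have rung : ∀ x, ladderAdj m (false, x) (true, x) → Even x → c (false, x) (true, x) =
      (f (false, x))⁻¹ * φ (ladderLabel m (false, x) (true, x)) * f (true, x) := by
    intro x h he
    have h2 : 2 ≤ x := h.2.1.2 rfl
    have hx : x ≤ 2 * m + 2 := h.1.1
    obtain ⟨y, hy⟩ := he
    obtain rfl | h4 := h2.eq_or_lt
    · have hf : f (true, 2) = f (false, 2) * c (false, 2) (true, 2) := rfl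
      rw [hf]
      simp [ladderLabel, ladderRung_two]
    · obtain ⟨i, rfl⟩ : ∃ i : Fin m, x = 2 * i + 4 := ⟨⟨y - 2, by omega⟩, by dsimp only; omega⟩
      simp [ladderLabel, ladderRung_of, φ, mul_assoc]
  refine ⟨φ, f, ?_⟩
  rintro ⟨j, x⟩ ⟨k, y⟩ h
  obtain ⟨h1, h2, h3⟩ | ⟨h1, h2, h3⟩ := h.2.2
  · dsimp only at h1 h2 h3
    subst h1
    obtain rfl | rfl | rfl : y = x + 1 ∨ x = y + 1 ∨ x = y := by omega
    · exact rail j x h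
    · exact swap _ _ (ladderAdj_symm _ _ h) (rail j y (ladderAdj_symm _ _ h))
    · rw [hc.self h]
      simp [ladderLabel]
  · dsimp only at h1 h2 h3
    subst h2
    cases j <;> cases k <;> simp only [ne_eq, not_true_eq_false] at h1
    · exact rung x h h3
    · exact swap _ _ (ladderAdj_symm _ _ h) (rung x (ladderAdj_symm _ _ h) h3)

end Ladder

section Track

theorem exists_sequence_extending {α : Type} {R : α → α → Prop} {f : ℕ → α} {n : ℕ}
    (hf : ∀ s < n, R (f s) (f (s + 1))) {y : α} (h : Relation.ReflTransGen R (f n) y) :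
    ∃ (f' : ℕ → α) (n' : ℕ), n ≤ n' ∧ (∀ s ≤ n, f' s = f s) ∧
      (∀ s < n', R (f' s) (f' (s + 1))) ∧ f' n' = y := by
  induction h with
  | refl => exact ⟨f, n, le_rfl, fun _ _ => rfl, hf, rfl⟩
  | @tail y z _ hyz ih =>
    obtain ⟨f', n', hn, heq, hR, rfl⟩ := ih
    refine ⟨update f' (n' + 1) z, n' + 1, hn.trans (Nat.le_succ n'), fun s hs => ?_,
      fun s hs => ?_, update_self ..⟩
    · rw [update_of_ne (by omega), heq s hs]
    · rw [update_of_ne (by omega)]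
      obtain rfl | hs' := Nat.lt_succ_iff_lt_or_eq.1 hs |>.symm
      · rwa [update_self]
      · rw [update_of_ne (by omega)]
        exact hR s hs'

/-- If any two members of `P` are linked by chains of `R`, a single chain visits a given finite
subset of `P`. -/
theorem exists_sequence_visiting {α : Type} {R : α → α → Prop} {P : Set α}
    (hP : ∀ x ∈ P, ∀ y ∈ P, Relation.ReflTransGen R x y) {a : α} (ha : a ∈ P) {S : Set α}
    (hS : S.Finite) (hSP : S ⊆ P) :
    ∃ (f : ℕ → α) (n : ℕ), f 0 = a ∧ (∀ s < n, R (f s) (f (s + 1))) ∧ f n ∈ P ∧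
      ∀ x ∈ S, ∃ s ≤ n, f s = x := by
  induction S, hS using Set.Finite.induction_on with
  | empty => exact ⟨fun _ => a, 0, rfl, by simp, ha, by simp⟩
  | @insert x S _ _ ih =>
    obtain ⟨f, n, h0, hR, hn, hv⟩ := ih ((Set.subset_insert x S).trans hSP)
    have hx := hSP (Set.mem_insert x S)
    obtain ⟨f', n', hnn, heq, hR', hn'⟩ := exists_sequence_extending hR (hP _ hn x hx)
    refine ⟨f', n', by rw [heq 0 (Nat.zero_le n), h0], hR', hn' ▸ hx, ?_⟩
    rintro y (rfl | hy)
    · exact ⟨n', le_rfl, hn'⟩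
    · obtain ⟨s, hs, rfl⟩ := hv y hy
      exact ⟨s, hs.trans hnn, heq s hs⟩

variable {m : ℕ} {G : Type} [Group G] {proj : FreeGroup (Fin m) →* G}

/-- A state `(u, w)` of a walk on the ladder is admissible if `w` is compatible with the label of
the edge from the base vertex to `u`, whenever there is one. -/
def LadderAdmissible (proj : FreeGroup (Fin m) →* G) (q : (Bool × ℕ) × FreeGroup (Fin m)) : Prop :=
  ladderAdj m (false, 0) q.1 → proj q.2 = proj (ladderLabel m (false, 0) q.1)

/-- A step along an edge of the ladder to an admissible state. -/
def LadderStep (proj : FreeGroup (Fin m) →* G) (p q : (Bool × ℕ) × FreeGroup (Fin m)) : Prop :=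
  ladderAdj m p.1 q.1 ∧ q.2 = p.2 * ladderLabel m p.1 q.1 ∧ LadderAdmissible proj q

theorem ladderAdmissible_of_two_le {q : (Bool × ℕ) × FreeGroup (Fin m)} (h : 2 ≤ q.1.2) :
    LadderAdmissible proj q := by
  rintro ⟨-, -, h' | h'⟩
  · dsimp only at h'
    omega
  · dsimp only at h'
    omega

theorem ladderAdmissible_of_proj_eq_one {x : ℕ} {w : FreeGroup (Fin m)} (h : proj w = 1) :
    LadderAdmissible proj ((false, x), w) := by
  intro _
  simp [h, ladderLabel]

theorem LabelledReach.reflTransGen_ladderStep {u v : Bool × ℕ} {g : FreeGroup (Fin m)}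
    (h : LabelledReach (ladderFarAdj m) (ladderLabel m) u v g) (w : FreeGroup (Fin m)) :
    Relation.ReflTransGen (LadderStep proj) (u, w) (v, w * g) := by
  induction h with
  | refl => rw [mul_one]
  | step _ h ih =>
    exact ih.tail ⟨h.1, (mul_assoc ..).symm, ladderAdmissible_of_two_le h.2.2⟩

theorem reflTransGen_ladderStep {w w' : FreeGroup (Fin m)} (h : proj w = 1) (h' : proj w' = 1) :
    Relation.ReflTransGen (LadderStep proj) ((false, 0), w) ((false, 0), w') := by
  have e (x : ℕ) (hx : x < 2 * m + 2) : ladderAdj m (false, x) (false, x + 1) :=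
    ladderAdj_rail ⟨hx.le, by simp⟩ hx
  have up (x : ℕ) (hx : x < 2 * m + 2) {w : FreeGroup (Fin m)} (h : proj w = 1) :
      LadderStep proj ((false, x), w) ((false, x + 1), w) :=
    ⟨e x hx, by simp [ladderLabel], ladderAdmissible_of_proj_eq_one h⟩
  have down (x : ℕ) (hx : x < 2 * m + 2) {w : FreeGroup (Fin m)} (h : proj w = 1) :
      LadderStep proj ((false, x + 1), w) ((false, x), w) :=
    ⟨ladderAdj_symm _ _ (e x hx), by simp [ladderLabel], ladderAdmissible_of_proj_eq_one h⟩
  have loop := (ladderReach_loop (w⁻¹ * w')).reflTransGen_ladderStep (proj := proj) w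
  rw [mul_inv_cancel_left] at loop
  exact ((((Relation.ReflTransGen.single (up 0 (by omega) h)).tail (up 1 (by omega) h)).trans
    loop).tail (down 1 (by omega) h')).tail (down 0 (by omega) h')

/-- The ladder carries a track whose returns to the base vertex spell all the relators of a finite
presentation. -/
theorem exists_labelledTrack (m : ℕ) (rels : Finset (FreeGroup (Fin m))) :
    ∃ D : LabelledTrack (Bool × ℕ) (FreeGroup (Fin m))
        (PresentedGroup (rels : Set (FreeGroup (Fin m)))),
      D.adj = ladderAdj m ∧ D.base = (false, 0) ∧ D.height = 2 * m + 4 := by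
  let proj := PresentedGroup.mk (rels : Set (FreeGroup (Fin m)))
  obtain ⟨f, n, h0, hR, -, hv⟩ := exists_sequence_visiting (R := LadderStep proj)
    (P := {q | q.1 = (false, 0) ∧ proj q.2 = 1}) (a := ((false, 0), 1))
    (S := (fun r => ((false, 0), r)) '' (rels : Set (FreeGroup (Fin m))))
    (by
      rintro ⟨_, w⟩ ⟨rfl, h⟩ ⟨_, w'⟩ ⟨rfl, h'⟩
      exact reflTransGen_ladderStep h h')
    ⟨rfl, map_one _⟩ (rels.finite_toSet.image _)
    (by
      rintro _ ⟨r, hr, rfl⟩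
      exact ⟨rfl, PresentedGroup.one_of_mem hr⟩)
  have base_mem : ((false, 0) : Bool × ℕ) ∈ ladderVertices m := ⟨Nat.zero_le _, by simp⟩
  have mem : ∀ s ≤ n, (f s).1 ∈ ladderVertices m ∧ LadderAdmissible proj (f s) := by
    rintro (_ | s) hs
    · rw [h0]
      exact ⟨base_mem, ladderAdmissible_of_proj_eq_one (map_one _)⟩
    · exact ⟨(hR s hs).1.2.1, (hR s hs).2.2⟩
  exact ⟨{
    adj := ladderAdj m
    label := ladderLabel m
    proj := proj
    base := (false, 0)
    length := n
    height := 2 * m + 4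
    pos := fun s => (f s).1
    word := fun s => (f s).2
    adj_symm := ladderAdj_symm
    adj_self := ladderAdj_self
    isCocycle_label := isCocycle_ladderLabel
    classify := ladder_classify
    adj_base := ladderAdj_self_of_mem base_mem
    reach_base := ladderReach_base_loop
    exists_reach := exists_ladderReach_base
    proj_surjective := PresentedGroup.mk_surjective _
    two_le_height := by omega
    pos_zero := by rw [h0]
    word_zero := by rw [h0]
    adj_pos := fun s hs => ladderAdj_self_of_mem (mem s hs).1
    adj_pos_succ := fun s hs => (hR s hs).1
    word_succ := fun s hs => (hR s hs).2.1
    proj_word := fun s hs => (mem s hs).2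
    lift := by
      intro H _ φ hφ
      have hlift : FreeGroup.lift (fun i => φ (FreeGroup.of i)) = φ := by
        ext i
        simp
      refine ⟨PresentedGroup.toGroup (f := fun i => φ (FreeGroup.of i)) fun r hr => ?_,
        fun x => ?_⟩
      · obtain ⟨s, hs, e⟩ := hv _ ⟨r, hr, rfl⟩
        rw [hlift]
        simpa [e] using hφ s hs (by rw [e])
      · exact DFunLike.congr_fun hlift x }, rfl, rfl, rfl⟩

end Track

section Embedding

theorem sum_sq_lt_iff (a b s t : ℤ) :
    100 * a ^ 2 + 81 * b ^ 2 + 100 * s ^ 2 + 100 * t ^ 2 < 400 ↔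
      (|a| ≤ 1 ∧ |b| ≤ 1 ∧ |s| ≤ 1 ∧ |t| ≤ 1) ∨ (a = 0 ∧ |b| = 2 ∧ s = 0 ∧ t = 0) := by
  have small {z : ℤ} : |z| ≤ 1 ↔ z ^ 2 ≤ 1 := sq_le_one_iff_abs_le_one z |>.symm
  constructor
  · intro h
    have ha := sq_nonneg a
    have hb := sq_nonneg b
    have hs := sq_nonneg s
    have ht := sq_nonneg t
    have lt_two {z : ℤ} (hz : z ^ 2 < 4) : |z| ≤ 1 := by
      have : |z| < |2| := sq_lt_sq.1 (by linarith)
      rw [abs_two] at this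
      omega
    have ha' := lt_two (z := a) (by omega)
    have hs' := lt_two (z := s) (by omega)
    have ht' := lt_two (z := t) (by omega)
    have hb' : |b| < |3| := sq_lt_sq.1 (by omega)
    rw [abs_of_pos (by norm_num : (0 : ℤ) < 3)] at hb'
    obtain hb1 | hb2 : |b| ≤ 1 ∨ |b| = 2 := by omega
    · exact Or.inl ⟨ha', hb1, hs', ht'⟩
    · rw [← sq_abs b, hb2] at h
      exact Or.inr ⟨pow_eq_zero_iff two_ne_zero |>.1 (by omega), hb2,
        pow_eq_zero_iff two_ne_zero |>.1 (by omega), pow_eq_zero_iff two_ne_zero |>.1 (by omega)⟩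
  · rintro (⟨ha, hb, hs, ht⟩ | ⟨rfl, hb, rfl, rfl⟩)
    · rw [small] at ha hb hs ht
      omega
    · rw [← sq_abs b, hb]
      norm_num

theorem dist_lt_one_iff (a b s t a' b' s' t' : ℕ) :
    dist !₂[(a : ℝ) / 2, 9 / 20 * b, s / 2, t / 2] !₂[(a' : ℝ) / 2, 9 / 20 * b', s' / 2, t' / 2]
      < 1 ↔
      (a ≤ a' + 1 ∧ a' ≤ a + 1 ∧ b ≤ b' + 1 ∧ b' ≤ b + 1 ∧ s ≤ s' + 1 ∧ s' ≤ s + 1 ∧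
        t ≤ t' + 1 ∧ t' ≤ t + 1) ∨ (a = a' ∧ (b = b' + 2 ∨ b' = b + 2) ∧ s = s' ∧ t = t') := by
  have key := sum_sq_lt_iff (a - a') (b - b') (s - s') (t - t')
  have cast : dist !₂[(a : ℝ) / 2, 9 / 20 * b, s / 2, t / 2]
      !₂[(a' : ℝ) / 2, 9 / 20 * b', s' / 2, t' / 2] < 1 ↔
      100 * (a - a' : ℤ) ^ 2 + 81 * (b - b' : ℤ) ^ 2 + 100 * (s - s' : ℤ) ^ 2 +
        100 * (t - t' : ℤ) ^ 2 < 400 := by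
    rw [EuclideanSpace.dist_eq, Real.sqrt_lt' one_pos, ← Int.cast_lt (R := ℝ)]
    simp only [Fin.sum_univ_four, Real.dist_eq, sq_abs]
    push_cast
    simp
    constructor <;> intro h <;> linarith
  rw [cast, key]
  simp only [abs_le, abs_eq (zero_le_two (α := ℤ))]
  omega

/-- The second coordinate of the ladder in the plane. -/
def ladderHeight (u : Bool × ℕ) : ℕ :=
  if u.1 then (if u.2 % 2 = 0 then 2 else 3) else if u.2 % 2 = 0 ∧ 2 ≤ u.2 then 1 else 0

/-- The position in `ℝ⁴` of a vertex of the complex built from a track on the ladder: the ladder is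
shrunk as the last coordinate increases. -/
noncomputable def ladderPoint (m : ℕ) (v : (Bool × ℕ) × ℕ × ℕ) : EuclideanSpace ℝ (Fin 4) :=
  !₂[((min v.1.2 (2 * m + 5 - v.2.2) : ℕ) : ℝ) / 2,
    9 / 20 * (min (ladderHeight v.1) (2 * m + 5 - v.2.2) : ℕ), (v.2.1 : ℝ) / 2, (v.2.2 : ℝ) / 2]

theorem ladderAdj_iff {m : ℕ} {u v : Bool × ℕ} (hu : u ∈ ladderVertices m)
    (hv : v ∈ ladderVertices m) : ladderAdj m u v ↔
      u.2 ≤ v.2 + 1 ∧ v.2 ≤ u.2 + 1 ∧ ladderHeight u ≤ ladderHeight v + 1 ∧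
        ladderHeight v ≤ ladderHeight u + 1 := by
  obtain ⟨j, x⟩ := u
  obtain ⟨k, y⟩ := v
  simp only [ladderAdj, hu, hv, true_and, Nat.even_iff]
  have h1 := hu.2
  have h2 := hv.2
  cases j <;> cases k <;> simp [ladderHeight] at h1 h2 ⊢ <;> split_ifs <;> omega

theorem ladderHeight_ne {m : ℕ} {u v : Bool × ℕ} (hu : u ∈ ladderVertices m)
    (hv : v ∈ ladderVertices m) (h : u.2 = v.2) : ladderHeight u ≠ ladderHeight v + 2 := by
  obtain ⟨j, x⟩ := u
  obtain ⟨k, y⟩ := v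
  have h1 := hu.2
  have h2 := hv.2
  dsimp only at h
  subst h
  cases j <;> cases k <;>
    simp only [ladderHeight, Bool.false_eq_true, if_false, if_true] at h1 h2 ⊢ <;>
    split_ifs <;> simp at h1 h2 ⊢ <;> omega

theorem ladderHeight_le (u : Bool × ℕ) : ladderHeight u ≤ 3 := by
  unfold ladderHeight
  split_ifs <;> omega

theorem ladderHeight_le_snd {m : ℕ} {u : Bool × ℕ} (hu : u ∈ ladderVertices m) :
    ladderHeight u ≤ u.2 := by
  have := hu.2
  unfold ladderHeight
  split_ifs with h1 <;> [have := this h1; have := this h1; skip; skip] <;> omega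

variable {m : ℕ} {F G : Type} [Group F] [Group G] {D : LabelledTrack (Bool × ℕ) F G}

/-- The embedding in `ℝ⁴` realizes the adjacency relation of the complex built from a track. -/
theorem dist_ladderPoint_lt_one_iff (hadj : D.adj = ladderAdj m) (hbase : D.base = (false, 0))
    (hheight : D.height = 2 * m + 4) {v w : (Bool × ℕ) × ℕ × ℕ} (hv : v ∈ D.vertices)
    (hw : w ∈ D.vertices) : dist (ladderPoint m v) (ladderPoint m w) < 1 ↔ D.Adj v w := by
  have hbv : ladderHeight D.base = 0 := by rw [hbase]; rfl
  have hbx : D.base.2 = 0 := by rw [hbase]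
  have pos_adj : ∀ s s', s ≤ D.length → s' ≤ D.length → s ≤ s' + 1 → s' ≤ s + 1 →
      D.adj (D.pos s) (D.pos s') := by
    intro s s' hs hs' h h'
    obtain rfl | rfl | rfl : s' = s + 1 ∨ s = s' + 1 ∨ s = s' := by omega
    · exact D.adj_pos_succ s hs'
    · exact D.adj_symm _ _ (D.adj_pos_succ s' hs)
    · exact D.adj_pos s hs
  obtain ⟨u, s, t⟩ := v
  obtain ⟨u', s', t'⟩ := w
  have hu : u ∈ ladderVertices m := by
    have := hv.1
    rw [hadj] at this
    exact this.1
  have hu' : u' ∈ ladderVertices m := by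
    have := hw.1
    rw [hadj] at this
    exact this.1
  have hiff := ladderAdj_iff hu hu'
  rw [← hadj] at hiff
  have hne := ladderHeight_ne hu hu'
  have hne' := ladderHeight_ne hu' hu
  have h3 := ladderHeight_le u
  have h3' := ladderHeight_le u'
  have hyx := ladderHeight_le_snd hu
  have hyx' := ladderHeight_le_snd hu'
  have hx := hu.1
  have hx' := hu'.1
  have hs : s ≤ D.length := hv.2.1
  have hs' : s' ≤ D.length := hw.2.1
  have ht : t ≤ D.height := hv.2.2.1
  have ht' : t' ≤ D.height := hw.2.2.1
  have hcv : t = 0 ∨ u = D.base ∨ u = D.pos s := hv.2.2.2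
  have hcw : t' = 0 ∨ u' = D.base ∨ u' = D.pos s' := hw.2.2.2
  rw [ladderPoint, ladderPoint, dist_lt_one_iff, LabelledTrack.Adj]
  simp only [hv, hw, true_and, hiff]
  by_cases h0 : t = 0 ∨ t' = 0
  · constructor
    · rintro (h | h)
      · exact ⟨by omega, by omega, Or.inl (by omega)⟩
      · omega
    · rintro ⟨h1, h2, h | h | h⟩ <;> omega
  obtain hcv | hcv := hcv.resolve_left fun h => h0 (Or.inl h)
  · have hxb : u.2 = 0 := by rw [hcv, hbx]
    have hyb : ladderHeight u = 0 := by rw [hcv, hbv]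
    constructor
    · intro h
      refine ⟨by omega, by omega, ?_⟩
      by_cases htop : t' = D.height
      · exact Or.inr (Or.inl ⟨hcv, htop⟩)
      · exact Or.inl (by omega)
    · rintro ⟨h1, h2, h | h | ⟨h, h'⟩⟩
      · omega
      · omega
      · have hxb' : u'.2 = 0 := by rw [h, hbx]
        have hyb' : ladderHeight u' = 0 := by rw [h, hbv]
        omega
  obtain hcw | hcw := hcw.resolve_left fun h => h0 (Or.inr h)
  · have hxb : u'.2 = 0 := by rw [hcw, hbx]
    have hyb : ladderHeight u' = 0 := by rw [hcw, hbv]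
    constructor
    · intro h
      refine ⟨by omega, by omega, ?_⟩
      by_cases htop : t = D.height
      · exact Or.inr (Or.inr ⟨hcw, htop⟩)
      · exact Or.inl (by omega)
    · rintro ⟨h1, h2, h | ⟨h, h'⟩ | h⟩
      · omega
      · have hxb' : u.2 = 0 := by rw [h, hbx]
        have hyb' : ladderHeight u = 0 := by rw [h, hbv]
        omega
      · omega
  · have hp := pos_adj s s' hs hs'
    rw [← hcv, ← hcw, hiff] at hp
    constructor
    · intro h
      exact ⟨by omega, by omega, Or.inl (hp (by omega) (by omega))⟩
    · rintro ⟨⟨h1, h2⟩, h3, -⟩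
      have := hp h1 h2
      omega

theorem LabelledTrack.vertices_finite (hadj : D.adj = ladderAdj m) : D.vertices.Finite := by
  refine (((Set.finite_univ (α := Bool)).prod (Set.finite_Iic (2 * m + 2))).prod
    ((Set.finite_Iic D.length).prod (Set.finite_Iic D.height))).subset ?_
  rintro ⟨⟨j, x⟩, s, t⟩ ⟨h, hs, ht, -⟩
  rw [hadj] at h
  exact ⟨⟨trivial, h.1.1⟩, hs, ht⟩

end Embedding

/-- **All finitely presented groups arise from Rips complexes in `ℝ⁴`.** For every
finitely presented group `G` (a group isomorphic to a group presented by finitely many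
generators and relations) there is a finite subset `X ⊆ ℝ⁴` such that the fundamental
group of the Rips complex `R(X)` is isomorphic to `G`. -/
theorem rips_fundamental_group_universality (G : Type) [Group G]
    (hG : ∃ (m : ℕ) (rels : Finset (FreeGroup (Fin m))),
      Nonempty (G ≃* PresentedGroup (rels : Set (FreeGroup (Fin m))))) :
    ∃ X : Set (EuclideanSpace ℝ (Fin 4)), X.Finite ∧
      ∃ x : ripsRealization X, Nonempty (FundamentalGroup (ripsRealization X) x ≃* G) := by
  obtain ⟨m, rels, ⟨e⟩⟩ := hG
  obtain ⟨D, hadj, hbase, hheight⟩ := exists_labelledTrack m rels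
  obtain ⟨X, hX, x, ⟨e'⟩⟩ := exists_ripsRealization_fundamentalGroup_mulEquiv D.vertices
    (LabelledTrack.vertices_finite hadj) (ladderPoint m) D.Adj
    (fun v w => ⟨fun h => ⟨h.1, h.2.1,
      (dist_ladderPoint_lt_one_iff hadj hbase hheight h.1 h.2.1).2 h⟩,
      fun h => (dist_ladderPoint_lt_one_iff hadj hbase hheight h.1 h.2.1).1 h.2.2⟩)
    D.cocycle LabelledTrack.isCocycle_cocycle LabelledTrack.classify_cocycle (D.base, 0, 0)
    (LabelledTrack.base_mem_vertices (Nat.zero_le _) (Nat.zero_le _))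
    LabelledTrack.reach_cocycle_base fun _ hv => LabelledTrack.exists_reach_cocycle hv
  exact ⟨X, hX, x, ⟨e'.trans e.symm⟩⟩
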